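/- arXiv:2510.08320 — 5 statements merged into one kernel-verified Lean document; each statement's English description precedes it below -/
import Mathlib

section
/- Let n ≥ 1 and let ρ and σ be density matrices on ℂ^D. Define the joint final state on (ℂ^D)^{⊗(2n-1)} = (ℂ^D)^{⊗n} ⊗ (ℂ^D)^{⊗(n-1)} (the first n factors being the output registers and the last n-1 factors the catalyst registers) by τ_full = (1/n) · [ ρ^{⊗n} ⊗ σ^{⊗(n-1)} + Σ_{i=0}^{n-2} σ^{⊗n} ⊗ ρ^{⊗(i+1)} ⊗ σ^{⊗(n-2-i)} ]. Then the partial trace of τ_full over the last n-1 factors equals (1/n) · ρ^{⊗n} + ((n-1)/n) · σ^{⊗n}. -/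
open Matrix
open scoped Kronecker ComplexOrder

/-- Tensor (Kronecker) product of a family of `D × D` matrices, acting on
`(ℂ^D)^{⊗ k}` whose index set is identified with `Fin k → Fin D`. -/
noncomputable def tensFam {D k : ℕ} (M : Fin k → Matrix (Fin D) (Fin D) ℂ) :
    Matrix (Fin k → Fin D) (Fin k → Fin D) ℂ :=
  Matrix.of fun x y => ∏ j, M j (x j) (y j)

/-- `k`-fold tensor power of a `D × D` matrix. -/
noncomputable def tensPow {D : ℕ} (k : ℕ) (ρ : Matrix (Fin D) (Fin D) ℂ) :
    Matrix (Fin k → Fin D) (Fin k → Fin D) ℂ :=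
  tensFam (fun _ : Fin k => ρ)

/-- The joint final state
`τ_full = (1/n) [ ρ^{⊗n} ⊗ σ^{⊗(n-1)} + Σ_{i=0}^{n-2} σ^{⊗n} ⊗ ρ^{⊗(i+1)} ⊗ σ^{⊗(n-2-i)} ]`
on `(ℂ^D)^{⊗ n} ⊗ (ℂ^D)^{⊗ (n-1)}` (output registers ⊗ catalyst registers). -/
noncomputable def tauFull {D : ℕ} (n : ℕ) (ρ σ : Matrix (Fin D) (Fin D) ℂ) :
    Matrix ((Fin n → Fin D) × (Fin (n - 1) → Fin D))
           ((Fin n → Fin D) × (Fin (n - 1) → Fin D)) ℂ :=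
  ((n : ℂ)⁻¹) • ((tensPow n ρ) ⊗ₖ (tensPow (n - 1) σ)
    + ∑ i ∈ Finset.range (n - 1),
        (tensPow n σ) ⊗ₖ tensFam (fun j : Fin (n - 1) => if (j : ℕ) < i + 1 then ρ else σ))

/-- Partial trace over the second (catalyst) registers. -/
noncomputable def ptraceR {D n m : ℕ}
    (M : Matrix ((Fin n → Fin D) × (Fin m → Fin D))
                ((Fin n → Fin D) × (Fin m → Fin D)) ℂ) :
    Matrix (Fin n → Fin D) (Fin n → Fin D) ℂ :=
  Matrix.of fun x x' => ∑ y : Fin m → Fin D, M (x, y) (x', y)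

theorem trace_tensFam {D k : ℕ} (M : Fin k → Matrix (Fin D) (Fin D) ℂ) :
    (tensFam M).trace = ∏ j, (M j).trace := by
  simp only [Matrix.trace, Matrix.diag_apply, tensFam, Matrix.of_apply]
  exact (Fintype.prod_sum fun j a => M j a a).symm

theorem ptraceR_kronecker {D n m : ℕ}
    (A : Matrix (Fin n → Fin D) (Fin n → Fin D) ℂ)
    (B : Matrix (Fin m → Fin D) (Fin m → Fin D) ℂ) :
    ptraceR (A ⊗ₖ B) = B.trace • A := by
  ext x x'
  simp [ptraceR, Matrix.trace, ← Finset.mul_sum, mul_comm]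

theorem ptraceR_add {D n m : ℕ}
    (A B : Matrix ((Fin n → Fin D) × (Fin m → Fin D)) ((Fin n → Fin D) × (Fin m → Fin D)) ℂ) :
    ptraceR (A + B) = ptraceR A + ptraceR B := by
  ext x x'
  simp [ptraceR, Finset.sum_add_distrib]

theorem ptraceR_smul {D n m : ℕ} (c : ℂ)
    (A : Matrix ((Fin n → Fin D) × (Fin m → Fin D)) ((Fin n → Fin D) × (Fin m → Fin D)) ℂ) :
    ptraceR (c • A) = c • ptraceR A := by
  ext x x'
  simp [ptraceR, Finset.mul_sum]

theorem ptraceR_sum {ι : Type*} {D n m : ℕ} (s : Finset ι)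
    (A : ι → Matrix ((Fin n → Fin D) × (Fin m → Fin D))
      ((Fin n → Fin D) × (Fin m → Fin D)) ℂ) :
    ptraceR (∑ i ∈ s, A i) = ∑ i ∈ s, ptraceR (A i) := by
  ext x x'
  simp only [ptraceR, Matrix.of_apply, Matrix.sum_apply]
  exact Finset.sum_comm

/-- Tracing out the catalyst registers of the joint final state yields the
target mixture `(1/n) ρ^{⊗n} + ((n-1)/n) σ^{⊗n}`. -/
theorem output_state_of_catalytic_protocol {D n : ℕ} (hn : 1 ≤ n)
    (ρ σ : Matrix (Fin D) (Fin D) ℂ)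
    (hρ : ρ.PosSemidef) (hρtr : ρ.trace = 1)
    (hσ : σ.PosSemidef) (hσtr : σ.trace = 1) :
    ptraceR (tauFull n ρ σ)
      = ((n : ℂ)⁻¹) • tensPow n ρ + (((n : ℂ) - 1) / (n : ℂ)) • tensPow n σ := by
  have hsum : ∀ i, (tensFam (fun j : Fin (n - 1) => if (j : ℕ) < i + 1 then ρ else σ)).trace
      = 1 := by
    intro i
    rw [trace_tensFam]
    refine Finset.prod_eq_one fun j _ => ?_
    split_ifs <;> assumption
  have hpow : (tensPow (n - 1) σ).trace = 1 := by
    simp [tensPow, trace_tensFam, hσtr]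
  simp only [tauFull, ptraceR_smul, ptraceR_add, ptraceR_sum, ptraceR_kronecker, hsum, hpow,
    one_smul, Finset.sum_const, Finset.card_range]
  rw [← Nat.cast_smul_eq_nsmul ℂ, Nat.cast_sub hn, Nat.cast_one, smul_add, smul_smul,
    inv_mul_eq_div]
end

section
/- Let D ≥ 3, m ≥ 1, let |Φ+⟩ = (e_0 ⊗ e_0 + e_1 ⊗ e_1)/√2 ∈ ℂ^D ⊗ ℂ^D, and let a, b ∈ ℂ with a ≠ 0. Then the vector a·|Φ+⟩^{⊗m} + b·(e_2 ⊗ e_2)^{⊗m} ∈ (ℂ^D ⊗ ℂ^D)^{⊗m}, regarded under the A|B bipartition as a vector in (ℂ^D)^{⊗m} ⊗ (ℂ^D)^{⊗m}, has Schmidt rank at least 2^m. -/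
open Matrix

/-- Schmidt rank of a vector `ψ ∈ H_A ⊗ H_B`: the rank of the matrix of its
coefficients in the standard product basis. -/
noncomputable def schmidtRank {A B : Type*} [Fintype A] [Fintype B]
    (ψ : A × B → ℂ) : ℕ :=
  (Matrix.of fun i j => ψ (i, j)).rank

/-- The maximally entangled two-qubit state `|Φ+⟩ = (e₀⊗e₀ + e₁⊗e₁)/√2`,
embedded in `ℂ^D ⊗ ℂ^D`. -/
noncomputable def phiPlus (D : ℕ) : Fin D × Fin D → ℂ :=
  fun p => if (p.1 : ℕ) = (p.2 : ℕ) ∧ (p.1 : ℕ) < 2 then ((Real.sqrt 2)⁻¹ : ℝ) else 0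

/-- `m`-fold tensor power of a vector of `ℂ^D ⊗ ℂ^D`, regrouped under the A|B
bipartition as a vector of `(ℂ^D)^{⊗m} ⊗ (ℂ^D)^{⊗m}`. -/
noncomputable def vecPairPow {D : ℕ} (m : ℕ) (ψ : Fin D × Fin D → ℂ) :
    (Fin m → Fin D) × (Fin m → Fin D) → ℂ :=
  fun p => ∏ j, ψ (p.1 j, p.2 j)

/-- The product vector `e₂ ⊗ e₂ ∈ ℂ^D ⊗ ℂ^D`. -/
noncomputable def e22 (D : ℕ) : Fin D × Fin D → ℂ :=
  fun p => if (p.1 : ℕ) = 2 ∧ (p.2 : ℕ) = 2 then 1 else 0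

/-- The coefficients of `|Φ+⟩^{⊗m}` on the qubit product basis form a scalar matrix. -/
theorem vecPairPow_phiPlus_castLE {D m : ℕ} (hD : 2 ≤ D) (x y : Fin m → Fin 2) :
    vecPairPow m (phiPlus D) (Fin.castLE hD ∘ x, Fin.castLE hD ∘ y) =
      if x = y then (((Real.sqrt 2)⁻¹ : ℝ) : ℂ) ^ m else 0 := by
  split_ifs with h
  · subst h
    simp only [vecPairPow, phiPlus, Function.comp_apply, Fin.val_castLE, Fin.isLt, and_self, if_true,
      Finset.prod_const, Finset.card_univ, Fintype.card_fin]
  · obtain ⟨j, hj⟩ := Function.ne_iff.mp h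
    exact Finset.prod_eq_zero (Finset.mem_univ j) (by simp [phiPlus, Fin.val_inj, hj])

/-- The vector `(e₂⊗e₂)^{⊗m}` vanishes on the qubit product basis. -/
theorem vecPairPow_e22_castLE {D m : ℕ} (hD : 2 ≤ D) (hm : 1 ≤ m) (x y : Fin m → Fin 2) :
    vecPairPow m (e22 D) (Fin.castLE hD ∘ x, Fin.castLE hD ∘ y) = 0 :=
  Finset.prod_eq_zero (Finset.mem_univ ⟨0, hm⟩) (by simp [e22, (x ⟨0, hm⟩).isLt.ne])

/-- For `a ≠ 0`, the vector `a·|Φ+⟩^{⊗m} + b·(e₂⊗e₂)^{⊗m}` has Schmidt rank at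
least `2^m` across the A|B bipartition. -/
theorem schmidtRank_perturbed_phiPlus_pow {D m : ℕ} (hD : 3 ≤ D) (hm : 1 ≤ m)
    (a b : ℂ) (ha : a ≠ 0) :
    2 ^ m ≤ schmidtRank (a • vecPairPow m (phiPlus D) + b • vecPairPow m (e22 D)) := by
  have hD₂ : 2 ≤ D := by lia
  let f : (Fin m → Fin 2) → Fin m → Fin D := fun x => Fin.castLE hD₂ ∘ x
  let c : ℂ := a * (((Real.sqrt 2)⁻¹ : ℝ) : ℂ) ^ m
  have hc : c ≠ 0 := by simp [c, ha]
  let A : Matrix (Fin m → Fin D) (Fin m → Fin D) ℂ := Matrix.of fun i j =>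
    (a • vecPairPow m (phiPlus D) + b • vecPairPow m (e22 D)) (i, j)
  have hA : A.submatrix f f = Matrix.diagonal fun _ => c := by
    ext x y
    simp [A, f, c, vecPairPow_phiPlus_castLE, vecPairPow_e22_castLE hD₂ hm, Matrix.diagonal_apply]
  calc 2 ^ m = (A.submatrix f f).rank := by rw [hA, Matrix.rank_diagonal]; simp [hc]
    _ ≤ A.rank := A.rank_submatrix_le f f
end

section
/- Let n ≥ 1, let |Φ+⟩ = (e_0 ⊗ e_0 + e_1 ⊗ e_1)/√2 ∈ ℂ³ ⊗ ℂ³, and define the density matrix τ = (1/(n+1)) · (|Φ+⟩⟨Φ+|)^{⊗(n+1)} + (n/(n+1)) · ((e_2⊗e_2)(e_2⊗e_2)†)^{⊗(n+1)} on (ℂ³ ⊗ ℂ³)^{⊗(n+1)}, regarded under the A|B bipartition as a matrix on (ℂ³)^{⊗(n+1)} ⊗ (ℂ³)^{⊗(n+1)}. Then every finite decomposition τ = Σ_i ψ_i ψ_i† with nonzero vectors ψ_i contains some ψ_i of Schmidt rank at least 2^{n+1}; consequently SN(τ) ≥ 2^{n+1}. -/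
open Matrix

/-- Schmidt number of a matrix on `H_A ⊗ H_B`: the minimum over all finite
decompositions `ρ = Σ_i ψᵢ ψᵢ†` into nonzero vectors of the maximal Schmidt rank
appearing in the decomposition. -/
noncomputable def SN {A B : Type*} [Fintype A] [Fintype B]
    (ρ : Matrix (A × B) (A × B) ℂ) : ℕ :=
  sInf { d | ∃ (k : ℕ) (ψ : Fin k → (A × B → ℂ)),
    (∀ i, ψ i ≠ 0) ∧ ρ = ∑ i, Matrix.vecMulVec (ψ i) (star (ψ i)) ∧
    ∀ i, schmidtRank (ψ i) ≤ d }

/-- The maximally entangled two-qubit state `|Φ+⟩ ∈ ℂ³ ⊗ ℂ³`. -/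
noncomputable def phi3 : Fin 3 × Fin 3 → ℂ :=
  fun p => if p.1 = p.2 ∧ (p.1 : ℕ) < 2 then ((Real.sqrt 2)⁻¹ : ℝ) else 0

/-- The product vector `e₂ ⊗ e₂ ∈ ℂ³ ⊗ ℂ³`. -/
noncomputable def e22v : Fin 3 × Fin 3 → ℂ :=
  fun p => if p.1 = 2 ∧ p.2 = 2 then 1 else 0

/-- The projector `|Φ+⟩⟨Φ+|`. -/
noncomputable def Pphi : Matrix (Fin 3 × Fin 3) (Fin 3 × Fin 3) ℂ :=
  Matrix.vecMulVec phi3 (star phi3)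

/-- The projector `(e₂⊗e₂)(e₂⊗e₂)†`. -/
noncomputable def Q22 : Matrix (Fin 3 × Fin 3) (Fin 3 × Fin 3) ℂ :=
  Matrix.vecMulVec e22v (star e22v)

/-- Tensor product of a family of matrices on `ℂ³ ⊗ ℂ³`, regrouped under the A|B
bipartition as a matrix on `(ℂ³)^{⊗m} ⊗ (ℂ³)^{⊗m}`. -/
noncomputable def pairTens {m : ℕ}
    (f : Fin m → Matrix (Fin 3 × Fin 3) (Fin 3 × Fin 3) ℂ) :
    Matrix ((Fin m → Fin 3) × (Fin m → Fin 3)) ((Fin m → Fin 3) × (Fin m → Fin 3)) ℂ :=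
  Matrix.of fun x y => ∏ j, f j (x.1 j, x.2 j) (y.1 j, y.2 j)

/-- The target state `τ = (1/(n+1)) |Φ+⟩⟨Φ+|^{⊗(n+1)} + (n/(n+1)) (e₂e₂†)^{⊗(n+1)}`
of Theorem 1, under the A|B bipartition. -/
noncomputable def tau (n : ℕ) :
    Matrix ((Fin (n + 1) → Fin 3) × (Fin (n + 1) → Fin 3))
           ((Fin (n + 1) → Fin 3) × (Fin (n + 1) → Fin 3)) ℂ :=
  (((n : ℂ) + 1)⁻¹) • pairTens (fun _ : Fin (n + 1) => Pphi)
    + ((n : ℂ) / ((n : ℂ) + 1)) • pairTens (fun _ : Fin (n + 1) => Q22)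

/-- The embedding of qubit strings into qutrit strings. -/
def qubitEmb {m : ℕ} (x : Fin m → Fin 2) : Fin m → Fin 3 := fun j => (x j).castSucc

/-- The `m`-fold tensor power of a vector in `ℂ³ ⊗ ℂ³` under the A|B bipartition. -/
noncomputable def pairPow (m : ℕ) (v : Fin 3 × Fin 3 → ℂ) :
    (Fin m → Fin 3) × (Fin m → Fin 3) → ℂ :=
  fun x => ∏ j, v (x.1 j, x.2 j)

lemma pairTens_vecMulVec (m : ℕ) (v : Fin 3 × Fin 3 → ℂ) :
    pairTens (fun _ : Fin m => vecMulVec v (star v)) =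
      vecMulVec (pairPow m v) (star (pairPow m v)) := by
  ext x y
  simp [pairTens, pairPow, vecMulVec_apply, Finset.prod_mul_distrib]

lemma tau_eq (n : ℕ) :
    tau n = ((n : ℂ) + 1)⁻¹ •
        vecMulVec (pairPow (n + 1) phi3) (star (pairPow (n + 1) phi3)) +
      ((n : ℂ) / ((n : ℂ) + 1)) •
        vecMulVec (pairPow (n + 1) e22v) (star (pairPow (n + 1) e22v)) := by
  simp only [tau, Pphi, Q22, pairTens_vecMulVec]

lemma pairPow_e22v_qubitEmb (n : ℕ) (x y : Fin (n + 1) → Fin 2) :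
    pairPow (n + 1) e22v (qubitEmb x, qubitEmb y) = 0 := by
  refine Finset.prod_eq_zero (Finset.mem_univ 0) ?_
  have : (x 0).castSucc ≠ (2 : Fin 3) := (Fin.castSucc_lt_last (x 0)).ne
  simp [e22v, qubitEmb, this]

lemma pairPow_phi3_qubitEmb_self {m : ℕ} (x : Fin m → Fin 2) :
    pairPow m phi3 (qubitEmb x, qubitEmb x) = (((Real.sqrt 2)⁻¹ : ℝ) : ℂ) ^ m := by
  have h (j : Fin m) : ((x j : ℕ)) < 2 := (x j).isLt
  simp [pairPow, phi3, qubitEmb, h]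

lemma pairPow_phi3_qubitEmb_of_ne {m : ℕ} {x y : Fin m → Fin 2} (hxy : x ≠ y) :
    pairPow m phi3 (qubitEmb x, qubitEmb y) = 0 := by
  obtain ⟨j, hj⟩ := Function.ne_iff.mp hxy
  exact Finset.prod_eq_zero (Finset.mem_univ j) (by simp [phi3, qubitEmb, hj])

open scoped ComplexOrder in
/-- If the quadratic form of `∑ᵢ ψᵢ ψᵢ†` vanishes at the functional `v ↦ v p - c * v q`, then this
functional annihilates every `ψᵢ`. -/
lemma eq_mul_of_sum_vecMulVec {ι I : Type*} [Fintype ι] {ψ : ι → I → ℂ} {p q : I} {c : ℂ}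
    (h : (∑ i, vecMulVec (ψ i) (star (ψ i))) p p
      - star c * (∑ i, vecMulVec (ψ i) (star (ψ i))) p q
      - c * (∑ i, vecMulVec (ψ i) (star (ψ i))) q p
      + c * star c * (∑ i, vecMulVec (ψ i) (star (ψ i))) q q = 0) (i : ι) :
    ψ i p = c * ψ i q := by
  have hz : (fun i => ψ i p - c * ψ i q) ⬝ᵥ star (fun i => ψ i p - c * ψ i q) = 0 := by
    rw [← h]
    simp only [Matrix.sum_apply, vecMulVec_apply, dotProduct, Finset.mul_sum,
      ← Finset.sum_sub_distrib, ← Finset.sum_add_distrib]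
    refine Finset.sum_congr rfl fun i _ => ?_
    simp only [Pi.star_apply, star_sub, star_mul']
    ring
  rw [dotProduct_self_star_eq_zero] at hz
  exact sub_eq_zero.mp (congrFun hz i)

lemma card_le_schmidtRank_of_submatrix_eq_smul_one {A B S : Type*} [Fintype A] [Fintype B]
    [Fintype S] [DecidableEq S] (ψ : A × B → ℂ) (f : S → A) (g : S → B) {a : ℂ} (ha : a ≠ 0)
    (h : (of fun i j => ψ (i, j)).submatrix f g = a • (1 : Matrix S S ℂ)) :
    Fintype.card S ≤ schmidtRank ψ := by
  have hu : IsUnit (a • (1 : Matrix S S ℂ)) := by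
    rw [isUnit_iff_isUnit_det]
    simp [ha]
  rw [← rank_of_isUnit _ hu, ← h]
  exact rank_submatrix_le _ _ _

lemma exists_two_pow_le_schmidtRank (n k : ℕ)
    (ψ : Fin k → ((Fin (n + 1) → Fin 3) × (Fin (n + 1) → Fin 3) → ℂ))
    (h : tau n = ∑ i, vecMulVec (ψ i) (star (ψ i))) :
    ∃ i, 2 ^ (n + 1) ≤ schmidtRank (ψ i) := by
  have hn : (n : ℂ) + 1 ≠ 0 := Nat.cast_add_one_ne_zero n
  have off (i : Fin k) {x y : Fin (n + 1) → Fin 2} (hxy : x ≠ y) :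
      ψ i (qubitEmb x, qubitEmb y) = 0 := by
    have := eq_mul_of_sum_vecMulVec (ψ := ψ) (p := (qubitEmb x, qubitEmb y))
      (q := (qubitEmb x, qubitEmb y)) (c := 0) (by
        simp [← h, tau_eq, vecMulVec_apply, pairPow_e22v_qubitEmb,
          pairPow_phi3_qubitEmb_of_ne hxy]) i
    simpa using this
  have diag (i : Fin k) (x : Fin (n + 1) → Fin 2) :
      ψ i (qubitEmb x, qubitEmb x) = ψ i (qubitEmb 0, qubitEmb 0) := by
    have := eq_mul_of_sum_vecMulVec (ψ := ψ) (p := (qubitEmb x, qubitEmb x))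
      (q := (qubitEmb 0, qubitEmb 0)) (c := 1) (by
        simp [← h, tau_eq, vecMulVec_apply, pairPow_e22v_qubitEmb,
          pairPow_phi3_qubitEmb_self]) i
    simpa using this
  obtain ⟨i, hi⟩ : ∃ i, ψ i (qubitEmb 0, qubitEmb 0) ≠ 0 := by
    by_contra! h0
    have := congrFun (congrFun h (qubitEmb 0, qubitEmb 0)) (qubitEmb 0, qubitEmb 0)
    simp [tau_eq, Matrix.sum_apply, vecMulVec_apply, h0, pairPow_e22v_qubitEmb,
      pairPow_phi3_qubitEmb_self, hn] at this
  refine ⟨i, ?_⟩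
  have := card_le_schmidtRank_of_submatrix_eq_smul_one (ψ i) qubitEmb qubitEmb hi (by
    ext x y
    by_cases hxy : x = y
    · subst hxy
      simp [diag i x]
    · simp [off i hxy, hxy])
  simpa using this

lemma exists_tau_decomposition (n : ℕ) (hn : 1 ≤ n) :
    ∃ ψ : Fin 2 → ((Fin (n + 1) → Fin 3) × (Fin (n + 1) → Fin 3) → ℂ),
      (∀ i, ψ i ≠ 0) ∧ tau n = ∑ i, vecMulVec (ψ i) (star (ψ i)) := by
  have scale (r : ℝ) (hr : 0 ≤ r) (v : (Fin (n + 1) → Fin 3) × (Fin (n + 1) → Fin 3) → ℂ) :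
      vecMulVec ((Real.sqrt r : ℂ) • v) (star ((Real.sqrt r : ℂ) • v)) =
        (r : ℂ) • vecMulVec v (star v) := by
    have hs : (Real.sqrt r : ℂ) * Real.sqrt r = r := by
      exact_mod_cast Real.mul_self_sqrt hr
    ext p q
    simp only [vecMulVec_apply, Pi.star_apply, Pi.smul_apply, smul_eq_mul, star_mul',
      Matrix.smul_apply, ← hs, Complex.star_def, Complex.conj_ofReal]
    ring
  have hn0 : (0 : ℝ) < n := by exact_mod_cast hn
  refine ⟨![(Real.sqrt (((n : ℝ) + 1)⁻¹) : ℂ) • pairPow (n + 1) phi3,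
    (Real.sqrt ((n : ℝ) / ((n : ℝ) + 1)) : ℂ) • pairPow (n + 1) e22v], ?_, ?_⟩
  · have h₁ : Real.sqrt (((n : ℝ) + 1)⁻¹) ≠ 0 := (Real.sqrt_pos.mpr (by positivity)).ne'
    have h₂ : Real.sqrt ((n : ℝ) / ((n : ℝ) + 1)) ≠ 0 :=
      (Real.sqrt_pos.mpr (by positivity)).ne'
    refine Fin.forall_fin_two.mpr ⟨?_, ?_⟩
    · refine smul_ne_zero (Complex.ofReal_ne_zero.mpr h₁) fun h => ?_
      have := congrFun h (qubitEmb 0, qubitEmb 0)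
      simp [pairPow_phi3_qubitEmb_self] at this
    · refine smul_ne_zero (Complex.ofReal_ne_zero.mpr h₂) fun h => ?_
      have := congrFun h (fun _ => 2, fun _ => 2)
      simp [pairPow, e22v] at this
  · rw [Fin.sum_univ_two, tau_eq]
    simp only [cons_val_zero, cons_val_one]
    rw [scale _ (by positivity), scale _ (by positivity)]
    push_cast
    rfl

/-- Every finite pure-state decomposition of `τ` contains a vector of Schmidt rank
at least `2^{n+1}`; consequently `SN(τ) ≥ 2^{n+1}`. -/
theorem tau_schmidt_number_lower_bound (n : ℕ) (hn : 1 ≤ n) :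
    (∀ (k : ℕ) (ψ : Fin k → ((Fin (n + 1) → Fin 3) × (Fin (n + 1) → Fin 3) → ℂ)),
      (∀ i, ψ i ≠ 0) →
      tau n = ∑ i, Matrix.vecMulVec (ψ i) (star (ψ i)) →
      ∃ i, 2 ^ (n + 1) ≤ schmidtRank (ψ i)) ∧
    2 ^ (n + 1) ≤ SN (tau n) := by
  refine ⟨fun k ψ _ h => exists_two_pow_le_schmidtRank n k ψ h, ?_⟩
  refine le_csInf ?_ ?_
  · obtain ⟨ψ, h0, h⟩ := exists_tau_decomposition n hn
    exact ⟨∑ i, schmidtRank (ψ i), 2, ψ, h0, h, fun i =>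
      Finset.single_le_sum (f := fun i => schmidtRank (ψ i)) (fun _ _ => Nat.zero_le _)
        (Finset.mem_univ i)⟩
  · rintro d ⟨k, ψ, -, h, hd⟩
    obtain ⟨i, hi⟩ := exists_two_pow_le_schmidtRank n k ψ h
    exact hi.trans (hd i)
end

section
/- Let ρ be a nonzero positive semidefinite matrix on H_A ⊗ H_B and ω a nonzero positive semidefinite matrix on H_{A'} ⊗ H_{B'}. Regard ρ ⊗ ω as a matrix on (H_A ⊗ H_{A'}) ⊗ (H_B ⊗ H_{B'}) via the reordering of tensor factors that groups A with A' and B with B'. Then SN(ρ ⊗ ω) ≤ SN(ρ) · SN(ω). -/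
open Matrix
open scoped ComplexOrder

/-- The tensor product `ρ ⊗ ω`, with tensor factors regrouped so that `A` is
paired with `A'` and `B` with `B'`. -/
noncomputable def kronRegroup {A B A' B' : Type*}
    (ρ : Matrix (A × B) (A × B) ℂ) (ω : Matrix (A' × B') (A' × B') ℂ) :
    Matrix ((A × A') × (B × B')) ((A × A') × (B × B')) ℂ :=
  Matrix.of fun x y =>
    ρ (x.1.1, x.2.1) (y.1.1, y.2.1) * ω (x.1.2, x.2.2) (y.1.2, y.2.2)

open scoped Kronecker

theorem Matrix.exists_eq_mul_of_rank {m n K : Type*} [Fintype m] [Fintype n] [Field K]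
    (M : Matrix m n K) :
    ∃ (U : Matrix m (Fin M.rank) K) (V : Matrix (Fin M.rank) n K), M = U * V := by
  classical
  let b : Module.Basis (Fin M.rank) K M.mulVecLin.range := Module.finBasis K _
  let c : n → M.mulVecLin.range := fun j => ⟨M.col j, Pi.single j 1, by simp⟩
  refine ⟨of fun i k => (b k : m → K) i, of fun k j => b.repr (c j) k, ?_⟩
  ext i j
  have h := congrFun (congrArg Subtype.val (b.sum_repr (c j))) i
  simp only [AddSubmonoidClass.coe_finsetSum, SetLike.val_smul, Finset.sum_apply, Pi.smul_apply,
    smul_eq_mul] at h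
  rw [mul_apply]
  exact h.symm.trans (Finset.sum_congr rfl fun k _ => mul_comm _ _)

theorem Matrix.rank_kronecker_le {m n m' n' K : Type*} [Fintype m] [Fintype n] [Fintype m']
    [Fintype n'] [Field K] (M : Matrix m n K) (N : Matrix m' n' K) :
    (M ⊗ₖ N).rank ≤ M.rank * N.rank := by
  obtain ⟨U, V, h⟩ := M.exists_eq_mul_of_rank
  obtain ⟨U', V', h'⟩ := N.exists_eq_mul_of_rank
  calc (M ⊗ₖ N).rank = ((U ⊗ₖ U') * (V ⊗ₖ V')).rank := by
        rw [← mul_kronecker_mul, ← h, ← h']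
    _ ≤ (U ⊗ₖ U').rank := rank_mul_le_left _ _
    _ ≤ M.rank * N.rank := by
        simpa using (U ⊗ₖ U').rank_le_card_width

/-- The Schmidt number may be bounded using decompositions over any finite index type. -/
theorem SN_le_of_eq_sum {A B ι : Type*} [Fintype A] [Fintype B] [Fintype ι]
    {ρ : Matrix (A × B) (A × B) ℂ} {d : ℕ} (ψ : ι → A × B → ℂ) (hψ : ∀ i, ψ i ≠ 0)
    (hρ : ρ = ∑ i, vecMulVec (ψ i) (star (ψ i))) (hd : ∀ i, schmidtRank (ψ i) ≤ d) :
    SN ρ ≤ d := by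
  let e := Fintype.equivFin ι
  refine Nat.sInf_le ⟨Fintype.card ι, ψ ∘ e.symm, fun i => hψ _, ?_, fun i => hd _⟩
  rw [hρ]
  exact (e.symm.sum_comp fun i => vecMulVec (ψ i) (star (ψ i))).symm

/-- The Schmidt number of a positive semidefinite matrix is attained by a decomposition. -/
theorem Matrix.PosSemidef.exists_schmidtRank_le_SN {A B : Type*} [Fintype A] [Fintype B]
    {ρ : Matrix (A × B) (A × B) ℂ} (hρ : ρ.PosSemidef) :
    ∃ (k : ℕ) (ψ : Fin k → (A × B → ℂ)),
      (∀ i, ψ i ≠ 0) ∧ ρ = ∑ i, vecMulVec (ψ i) (star (ψ i)) ∧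
      ∀ i, schmidtRank (ψ i) ≤ SN ρ := by
  classical
  refine Nat.sInf_mem (s := { d | ∃ (k : ℕ) (ψ : Fin k → (A × B → ℂ)),
    (∀ i, ψ i ≠ 0) ∧ ρ = ∑ i, vecMulVec (ψ i) (star (ψ i)) ∧
    ∀ i, schmidtRank (ψ i) ≤ d }) ?_
  obtain ⟨m, φ, hφ⟩ := posSemidef_iff_eq_sum_vecMulVec.mp hρ
  let e := Fintype.equivFin {i // φ i ≠ 0}
  refine ⟨Fintype.card B, _, fun i => φ (e.symm i), fun i => (e.symm i).2, ?_,
    fun i => rank_le_card_width _⟩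
  rw [e.symm.sum_comp fun i : {i // φ i ≠ 0} => vecMulVec (φ i) (star (φ i)), hφ,
    ← Finset.sum_subtype (Finset.univ.filter fun i => φ i ≠ 0) (by simp)
      fun i => vecMulVec (φ i) (star (φ i))]
  refine (Finset.sum_filter_of_ne fun i _ h => ?_).symm
  intro h0
  simp [h0] at h

/-- Sub-multiplicativity of the Schmidt number under tensor products:
`SN(ρ ⊗ ω) ≤ SN(ρ) · SN(ω)`. -/
theorem SN_kron_le {A B A' B' : Type*} [Fintype A] [Fintype B] [Fintype A'] [Fintype B']
    (ρ : Matrix (A × B) (A × B) ℂ) (ω : Matrix (A' × B') (A' × B') ℂ)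
    (hρ : ρ.PosSemidef) (hρ0 : ρ ≠ 0) (hω : ω.PosSemidef) (hω0 : ω ≠ 0) :
    SN (kronRegroup ρ ω) ≤ SN ρ * SN ω := by
  obtain ⟨k, ψ, hψ0, hψ, hψr⟩ := hρ.exists_schmidtRank_le_SN
  obtain ⟨l, φ, hφ0, hφ, hφr⟩ := hω.exists_schmidtRank_le_SN
  refine SN_le_of_eq_sum (ι := Fin k × Fin l)
    (fun p x => ψ p.1 (x.1.1, x.2.1) * φ p.2 (x.1.2, x.2.2)) (fun p h => ?_) ?_ fun p => ?_
  · obtain ⟨⟨a, b⟩, hx⟩ := Function.ne_iff.mp (hψ0 p.1)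
    obtain ⟨⟨a', b'⟩, hy⟩ := Function.ne_iff.mp (hφ0 p.2)
    exact mul_ne_zero hx hy (congrFun h ((a, a'), (b, b')))
  · refine Matrix.ext fun x y => ?_
    have h₁ := congrFun (congrFun hψ (x.1.1, x.2.1)) (y.1.1, y.2.1)
    have h₂ := congrFun (congrFun hφ (x.1.2, x.2.2)) (y.1.2, y.2.2)
    simp only [Matrix.sum_apply, vecMulVec_apply, Pi.star_apply] at h₁ h₂
    simp only [kronRegroup, of_apply, h₁, h₂, Matrix.sum_apply, vecMulVec_apply, Pi.star_apply,
      Finset.sum_mul_sum, Fintype.sum_prod_type, star_mul']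
    exact Finset.sum_congr rfl fun i _ => Finset.sum_congr rfl fun j _ => by ring
  · exact (rank_kronecker_le (of fun i j => ψ p.1 (i, j)) (of fun i j => φ p.2 (i, j))).trans
      (Nat.mul_le_mul (hψr _) (hφr _))
end

section
/- Let ψ be a vector in ℂ^a ⊗ ℂ^d ⊗ ℂ^b (registers A, C, B). Then the Schmidt rank of ψ with respect to the bipartition (A C)|B is at most d times the Schmidt rank of ψ with respect to the bipartition A|(C B). Equivalently, for the array ψ_{i,c,j}, the rank of the (a·d)×b matrix with entries ψ_{(i,c),j} is at most d times the rank of the a×(d·b) matrix with entries ψ_{i,(c,j)}. -/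
open Matrix

/-- Moving an index from the columns of a matrix to its rows multiplies the rank by at most the
number of values of that index. -/
theorem Matrix.rank_of_regroup_le {K A C B : Type*} [Field K] [Fintype A] [Fintype C] [Fintype B]
    (ψ : A → C → B → K) :
    (Matrix.of fun (p : A × C) (j : B) => ψ p.1 p.2 j).rank ≤
      Fintype.card C * (Matrix.of fun (i : A) (q : C × B) => ψ i q.1 q.2).rank := by
  classical
  set N : Matrix A (C × B) K := Matrix.of fun i q => ψ i q.1 q.2 with hN
  let L : (C → LinearMap.range N.mulVecLin) →ₗ[K] (A × C → K) :=
    { toFun := fun g p => (g p.2 : A → K) p.1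
      map_add' := fun _ _ => rfl
      map_smul' := fun _ _ => rfl }
  have hle : LinearMap.range (Matrix.of fun (p : A × C) (j : B) => ψ p.1 p.2 j).mulVecLin ≤
      LinearMap.range L := by
    rintro _ ⟨v, rfl⟩
    refine ⟨fun c => ⟨N.mulVecLin fun q => if q.1 = c then v q.2 else 0, _, rfl⟩, ?_⟩
    ext ⟨i, c⟩
    simp [L, hN, Matrix.mulVec, dotProduct, Fintype.sum_prod_type_right]
  calc (Matrix.of fun (p : A × C) (j : B) => ψ p.1 p.2 j).rank
      ≤ Module.finrank K (LinearMap.range L) := Submodule.finrank_mono hle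
    _ ≤ Module.finrank K (C → LinearMap.range N.mulVecLin) := LinearMap.finrank_range_le L
    _ = Fintype.card C * N.rank := by
      rw [Module.finrank_pi_fintype]
      simp [Matrix.rank]

/-- For a vector on three registers `A, C, B` with `dim C = d`, the Schmidt rank
across the bipartition `(A C)|B` is at most `d` times the Schmidt rank across
`A|(C B)`: sending a `d`-dimensional quantum system increases the Schmidt rank
by at most a factor `d`. -/
theorem schmidtRank_shift_register {a d b : ℕ}
    (ψ : Fin a × Fin d × Fin b → ℂ) :
    schmidtRank (fun q : (Fin a × Fin d) × Fin b => ψ (q.1.1, q.1.2, q.2))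
      ≤ d * schmidtRank (fun q : Fin a × (Fin d × Fin b) => ψ (q.1, q.2.1, q.2.2)) := by
  simpa [schmidtRank] using Matrix.rank_of_regroup_le fun i c j => ψ (i, c, j)
end
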